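/- arXiv:2303.12414 — 5 statements merged into one kernel-verified Lean document; each statement's English description precedes it below -/
import Mathlib

section
/- Let E be a real inner product space and f : E → ℝ a differentiable function that is μ-strongly convex and whose gradient is β-Lipschitz, with 0 < μ ≤ β. Then for every step size η with 0 ≤ η ≤ 2/(β+μ) and all w₁, w₂ ∈ E, ‖w₁ − w₂ − η(∇f(w₁) − ∇f(w₂))‖ ≤ (1 − μη)‖w₁ − w₂‖. -/
open scoped RealInnerProductSpace

/-- The descent lemma: a function with `β`-Lipschitz gradient lies below its quadratic models. -/
theorem le_quadratic_of_lipschitz_gradient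
    {E : Type*} [NormedAddCommGroup E] [InnerProductSpace ℝ E] [CompleteSpace E]
    {f : E → ℝ} {g : E → E} {β : ℝ}
    (hdiff : ∀ w, HasGradientAt f (g w) w)
    (hsmooth : ∀ w₁ w₂ : E, ‖g w₁ - g w₂‖ ≤ β * ‖w₁ - w₂‖) (y v : E) :
    f (y + v) ≤ f y + ⟪g y, v⟫ + β / 2 * ‖v‖ ^ 2 := by
  have hder : ∀ t : ℝ, HasDerivAt
      (fun t : ℝ => f (y + t • v) - t * ⟪g y, v⟫ - t ^ 2 * (β / 2 * ‖v‖ ^ 2))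
      (⟪g (y + t • v), v⟫ - ⟪g y, v⟫ - 2 * t * (β / 2 * ‖v‖ ^ 2)) t := by
    intro t
    have hline : HasDerivAt (fun t : ℝ => y + t • v) v t := by
      simpa using ((hasDerivAt_id t).smul_const v).const_add y
    have hf : HasDerivAt (fun t : ℝ => f (y + t • v)) ⟪g (y + t • v), v⟫ t := by
      have hcomp := (hdiff (y + t • v)).hasFDerivAt.comp_hasDerivAt t hline
      rw [InnerProductSpace.toDual_apply_apply] at hcomp
      exact hcomp
    have hlin := (hasDerivAt_id t).mul_const ⟪g y, v⟫
    have hsq := (hasDerivAt_pow 2 t).mul_const (β / 2 * ‖v‖ ^ 2)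
    exact ((hf.sub hlin).sub hsq).congr_deriv (by simp)
  have hanti : AntitoneOn
      (fun t : ℝ => f (y + t • v) - t * ⟪g y, v⟫ - t ^ 2 * (β / 2 * ‖v‖ ^ 2))
      (Set.Icc 0 1) := by
    refine antitoneOn_of_deriv_nonpos (convex_Icc 0 1)
      (fun t _ => (hder t).continuousAt.continuousWithinAt)
      (fun t _ => (hder t).differentiableAt.differentiableWithinAt) fun t ht => ?_
    rw [interior_Icc] at ht
    rw [(hder t).deriv, ← inner_sub_left]
    have hg : ‖g (y + t • v) - g y‖ ≤ β * (t * ‖v‖) := by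
      simpa [norm_smul, abs_of_pos ht.1] using hsmooth (y + t • v) y
    have hmul := mul_le_mul_of_nonneg_right hg (norm_nonneg v)
    have hcs := real_inner_le_norm (g (y + t • v) - g y) v
    linarith
  have h01 := hanti (Set.left_mem_Icc.2 zero_le_one) (Set.right_mem_Icc.2 zero_le_one) zero_le_one
  simp only [one_smul, zero_smul, add_zero] at h01
  linarith

/-- The quadratic lower bound of a strongly convex function with Lipschitz gradient, improved by
a term measuring the deviation of the gradient from that of the quadratic model. -/
theorem quadratic_add_norm_sq_le_of_strongConvex_of_lipschitz_gradient
    {E : Type*} [NormedAddCommGroup E] [InnerProductSpace ℝ E] [CompleteSpace E]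
    {f : E → ℝ} {g : E → E} {μ β : ℝ} (hμβ : μ < β)
    (hdiff : ∀ w, HasGradientAt f (g w) w)
    (hstrong : ∀ w₁ w₂ : E,
      f w₂ + ⟪g w₂, w₁ - w₂⟫ + μ / 2 * ‖w₁ - w₂‖ ^ 2 ≤ f w₁)
    (hsmooth : ∀ w₁ w₂ : E, ‖g w₁ - g w₂‖ ≤ β * ‖w₁ - w₂‖) (x y : E) :
    f x + ⟪g x, y - x⟫ + μ / 2 * ‖y - x‖ ^ 2
      + ‖g y - g x - μ • (y - x)‖ ^ 2 / (2 * (β - μ)) ≤ f y := by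
  have hL : 0 < β - μ := sub_pos.2 hμβ
  set u := g y - g x - μ • (y - x) with hu
  set t := (β - μ)⁻¹ with ht
  have htL : t * (β - μ) = 1 := inv_mul_cancel₀ hL.ne'
  have hupper := le_quadratic_of_lipschitz_gradient hdiff hsmooth y (-(t • u))
  have hlower := hstrong (y + -(t • u)) x
  have hsplit : y + -(t • u) - x = (y - x) - t • u := by abel
  have huu : ⟪g y, u⟫ - ⟪g x, u⟫ - μ * ⟪y - x, u⟫ = ‖u‖ ^ 2 := by
    rw [← real_inner_self_eq_norm_sq u, ← real_inner_smul_left, ← inner_sub_left,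
      ← inner_sub_left, ← hu]
  rw [hsplit, norm_sub_sq_real, inner_sub_right, real_inner_smul_right, real_inner_smul_right,
    norm_smul, mul_pow, Real.norm_eq_abs, sq_abs] at hlower
  rw [inner_neg_right, real_inner_smul_right, norm_neg, norm_smul, mul_pow, Real.norm_eq_abs,
    sq_abs] at hupper
  have hdiv : ‖u‖ ^ 2 / (2 * (β - μ)) = t * ‖u‖ ^ 2 / 2 := by
    rw [ht]; field_simp
  rw [hdiv]
  linear_combination hlower + hupper - t * huu + t * ‖u‖ ^ 2 / 2 * htL

/-- The strengthened co-coercivity of the gradient of a strongly convex function with Lipschitz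
gradient. -/
theorem inner_gradient_sub_ge_of_strongConvex_of_lipschitz_gradient
    {E : Type*} [NormedAddCommGroup E] [InnerProductSpace ℝ E] [CompleteSpace E]
    {f : E → ℝ} {g : E → E} {μ β : ℝ} (hμ : 0 ≤ μ) (hμβ : μ ≤ β)
    (hdiff : ∀ w, HasGradientAt f (g w) w)
    (hstrong : ∀ w₁ w₂ : E,
      f w₂ + ⟪g w₂, w₁ - w₂⟫ + μ / 2 * ‖w₁ - w₂‖ ^ 2 ≤ f w₁)
    (hsmooth : ∀ w₁ w₂ : E, ‖g w₁ - g w₂‖ ≤ β * ‖w₁ - w₂‖) (x y : E) :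
    β * μ * ‖x - y‖ ^ 2 + ‖g x - g y‖ ^ 2 ≤ (β + μ) * ⟪x - y, g x - g y⟫ := by
  have hneg : ⟪g x, y - x⟫ + ⟪g y, x - y⟫ = -⟪x - y, g x - g y⟫ := by
    rw [← neg_sub x y, inner_neg_right, real_inner_comm, real_inner_comm (x - y) (g y),
      inner_sub_right]
    ring
  rcases hμβ.eq_or_lt with rfl | hlt
  · have h₁ := hstrong x y
    have h₂ := hstrong y x
    rw [norm_sub_rev y x] at h₂
    have hmono : μ * ‖x - y‖ ^ 2 ≤ ⟪x - y, g x - g y⟫ := by linarith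
    have hsq := pow_le_pow_left₀ (norm_nonneg _) (hsmooth x y) 2
    rw [mul_pow] at hsq
    linear_combination hsq + 2 * mul_le_mul_of_nonneg_left hmono hμ
  · have h₁ := quadratic_add_norm_sq_le_of_strongConvex_of_lipschitz_gradient
      hlt hdiff hstrong hsmooth x y
    have h₂ := quadratic_add_norm_sq_le_of_strongConvex_of_lipschitz_gradient
      hlt hdiff hstrong hsmooth y x
    have hL : 0 < β - μ := sub_pos.2 hlt
    have hrev : g y - g x - μ • (y - x) = -(g x - g y - μ • (x - y)) := by module
    rw [hrev, norm_neg, norm_sub_rev y x] at h₁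
    have hsum : ‖g x - g y - μ • (x - y)‖ ^ 2 / (β - μ)
        ≤ ⟪x - y, g x - g y⟫ - μ * ‖x - y‖ ^ 2 := by
      have hhalf : ‖g x - g y - μ • (x - y)‖ ^ 2 / (β - μ)
          = 2 * (‖g x - g y - μ • (x - y)‖ ^ 2 / (2 * (β - μ))) := by field_simp
      linarith
    rw [div_le_iff₀ hL, norm_sub_sq_real, real_inner_smul_right, norm_smul, mul_pow,
      Real.norm_eq_abs, sq_abs, real_inner_comm] at hsum
    linarith

/-- For a differentiable, `μ`-strongly convex function `f` on a real inner
product space whose gradient `g` is `β`-Lipschitz (with `0 < μ ≤ β`), any step size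
`0 ≤ η ≤ 2/(β+μ)` satisfies
`‖w₁ - w₂ - η • (∇f w₁ - ∇f w₂)‖ ≤ (1 - μη) ‖w₁ - w₂‖`. -/
theorem dfl_contraction
    {E : Type*} [NormedAddCommGroup E] [InnerProductSpace ℝ E] [CompleteSpace E]
    (f : E → ℝ) (g : E → E) (μ β η : ℝ)
    (hμ : 0 < μ) (hμβ : μ ≤ β)
    (hdiff : ∀ w, HasGradientAt f (g w) w)
    (hstrong : ∀ w₁ w₂ : E,
      f w₂ + ⟪g w₂, w₁ - w₂⟫ + μ / 2 * ‖w₁ - w₂‖ ^ 2 ≤ f w₁)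
    (hsmooth : ∀ w₁ w₂ : E, ‖g w₁ - g w₂‖ ≤ β * ‖w₁ - w₂‖)
    (hη0 : 0 ≤ η) (hη : η ≤ 2 / (β + μ))
    (w₁ w₂ : E) :
    ‖w₁ - w₂ - η • (g w₁ - g w₂)‖ ≤ (1 - μ * η) * ‖w₁ - w₂‖ := by
  have hs : 0 < β + μ := by linarith
  have hηs : η * (β + μ) ≤ 2 := (le_div_iff₀ hs).1 hη
  have hcontr : 0 ≤ 1 - μ * η := by
    linarith [mul_le_mul_of_nonneg_left hμβ hη0]
  have hco := inner_gradient_sub_ge_of_strongConvex_of_lipschitz_gradient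
    hμ.le hμβ hdiff hstrong hsmooth w₁ w₂
  have hmono : 0 ≤ ⟪w₁ - w₂, g w₁ - g w₂⟫ - μ * ‖w₁ - w₂‖ ^ 2 := by
    have h₁ := hstrong w₁ w₂
    have h₂ := hstrong w₂ w₁
    rw [norm_sub_rev w₂ w₁, ← neg_sub w₁ w₂, inner_neg_right] at h₂
    rw [real_inner_comm, inner_sub_left]
    linarith
  refine (sq_le_sq₀ (norm_nonneg _) (mul_nonneg hcontr (norm_nonneg _))).1 ?_
  rw [norm_sub_sq_real, real_inner_smul_right, norm_smul, mul_pow, mul_pow, Real.norm_eq_abs,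
    sq_abs]
  have hco' := mul_le_mul_of_nonneg_left hco (sq_nonneg η)
  have hslack := mul_nonneg hη0 (mul_nonneg (sub_nonneg.2 hηs) hmono)
  linarith
end

section
/- Let F̄_1, …, F̄_N : ℝ^M → ℝ be differentiable functions, each μ-strongly convex and β-smooth (0 < μ ≤ β), let ϱ_c ≥ 0 with Σ_c ϱ_c = 1, let F = Σ_c ϱ_c F̄_c, let w* ∈ ℝ^M, and assume the inter-subnet gradient diversity bound ‖∇F̄_c(w) − ∇F(w)‖ ≤ δ + 2ωβ‖w − w*‖ for all c and all w, where δ, ω ≥ 0. Let 0 < η ≤ 2/(μ+β), let v_1, …, v_N ∈ ℝ^M, set v_c' = v_c − η∇F̄_c(v_c), v̄ = Σ_c ϱ_c v_c and v̄' = Σ_c ϱ_c v_c'. Then Σ_c ϱ_c ‖v_c' − v̄'‖ ≤ (1 + η(β − μ)) Σ_c ϱ_c ‖v_c − v̄‖ + 2ωηβ‖v̄ − w*‖ + ηδ. -/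
open scoped RealInnerProductSpace

section Gradient

variable {E : Type*} [NormedAddCommGroup E] [InnerProductSpace ℝ E]

/-- The descent lemma: a function with `β`-Lipschitz gradient lies below its quadratic model. -/
theorem le_quadratic_of_gradient_lipschitz [CompleteSpace E] {f : E → ℝ} {g : E → E} {β : ℝ}
    (hdiff : ∀ w, HasGradientAt f (g w) w)
    (hsmooth : ∀ w₁ w₂, ‖g w₁ - g w₂‖ ≤ β * ‖w₁ - w₂‖) (y d : E) :
    f (y + d) ≤ f y + ⟪g y, d⟫ + β / 2 * ‖d‖ ^ 2 := by
  have hderiv : ∀ t : ℝ, HasDerivAt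
      (fun t : ℝ ↦ f (y + t • d) - t * ⟪g y, d⟫ - β / 2 * ‖d‖ ^ 2 * t ^ 2)
      (⟪g (y + t • d), d⟫ - ⟪g y, d⟫ - β * ‖d‖ ^ 2 * t) t := by
    intro t
    have hline : HasDerivAt (fun t : ℝ ↦ y + t • d) d t := by
      simpa using ((hasDerivAt_id t).smul_const d).const_add y
    have hf : HasDerivAt (fun t : ℝ ↦ f (y + t • d)) ⟪g (y + t • d), d⟫ t := by
      exact (hdiff (y + t • d)).hasFDerivAt.comp_hasDerivAt t hline
    have hlin : HasDerivAt (fun t : ℝ ↦ t * ⟪g y, d⟫) ⟪g y, d⟫ t := by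
      simpa using (hasDerivAt_id t).mul_const ⟪g y, d⟫
    have hquad : HasDerivAt (fun t : ℝ ↦ β / 2 * ‖d‖ ^ 2 * t ^ 2) (β * ‖d‖ ^ 2 * t) t := by
      refine ((hasDerivAt_pow 2 t).const_mul (β / 2 * ‖d‖ ^ 2)).congr_deriv ?_
      push_cast
      ring
    exact (hf.sub hlin).sub hquad
  have hanti := antitoneOn_of_hasDerivWithinAt_nonpos (convex_Icc (0 : ℝ) 1)
    (fun t _ ↦ (hderiv t).continuousAt.continuousWithinAt)
    (fun t _ ↦ (hderiv t).hasDerivWithinAt) (by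
      intro t ht
      rw [interior_Icc] at ht
      have hcs := real_inner_le_norm (g (y + t • d) - g y) d
      have hlip := hsmooth (y + t • d) y
      rw [add_sub_cancel_left, norm_smul, Real.norm_of_nonneg ht.1.le] at hlip
      rw [inner_sub_left] at hcs
      nlinarith [mul_le_mul_of_nonneg_right hlip (norm_nonneg d)])
  have h := hanti (Set.left_mem_Icc.2 zero_le_one) (Set.right_mem_Icc.2 zero_le_one) zero_le_one
  simp only [one_smul, zero_smul, add_zero] at h
  linarith

theorem le_mul_of_forall_quadratic_le {a L C : ℝ} (hL : 0 ≤ L)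
    (h : ∀ t : ℝ, (2 * t - L * t ^ 2) * a ≤ C) : a ≤ L * C := by
  rcases hL.eq_or_lt with rfl | hL
  · by_contra! ha
    rw [zero_mul] at ha
    have := h ((C + 1) / (2 * a))
    field_simp at this
    linarith
  · have := h (1 / L)
    field_simp at this
    linarith

variable {f : E → ℝ} {g : E → E} {μ β : ℝ}

theorem norm_sq_gradient_sub_add_le_inner [CompleteSpace E] (hμβ : μ ≤ β)
    (hdiff : ∀ w, HasGradientAt f (g w) w)
    (hstrong : ∀ w₁ w₂, f w₂ + ⟪g w₂, w₁ - w₂⟫ + μ / 2 * ‖w₁ - w₂‖ ^ 2 ≤ f w₁)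
    (hsmooth : ∀ w₁ w₂, ‖g w₁ - g w₂‖ ≤ β * ‖w₁ - w₂‖) (x y : E) :
    ‖g x - g y‖ ^ 2 + μ * β * ‖x - y‖ ^ 2 ≤ (μ + β) * ⟪g x - g y, x - y⟫ := by
  have hhalf : ∀ (x y : E) (t : ℝ), f x - f y - ⟪g x, x - y⟫ + μ / 2 * ‖x - y‖ ^ 2 +
      (t - (β - μ) / 2 * t ^ 2) * ‖(g x - g y) - μ • (x - y)‖ ^ 2 ≤ 0 := by
    intro x y t
    obtain ⟨e, he⟩ : ∃ e, e = (g x - g y) - μ • (x - y) := ⟨_, rfl⟩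
    rw [← he]
    have hlow := hstrong (y + t • e) x
    have hupp := le_quadratic_of_gradient_lipschitz hdiff hsmooth y (t • e)
    have hsub : y + t • e - x = t • e - (x - y) := by abel
    have hee : ‖e‖ ^ 2 = ⟪g x, e⟫ - ⟪g y, e⟫ - μ * ⟪e, x - y⟫ := by
      rw [← real_inner_self_eq_norm_sq]
      nth_rewrite 1 [he]
      rw [inner_sub_left, inner_sub_left, real_inner_smul_left, real_inner_comm e (x - y)]
    rw [hsub, inner_sub_right, norm_sub_sq_real, norm_smul, real_inner_smul_left,
      real_inner_smul_right, mul_pow, Real.norm_eq_abs, sq_abs] at hlow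
    rw [norm_smul, real_inner_smul_right, mul_pow, Real.norm_eq_abs, sq_abs] at hupp
    linear_combination hlow + hupp + t * hee
  have hquad : ∀ t : ℝ, (2 * t - (β - μ) * t ^ 2) * ‖(g x - g y) - μ • (x - y)‖ ^ 2 ≤
      ⟪g x - g y, x - y⟫ - μ * ‖x - y‖ ^ 2 := by
    intro t
    have h₁ := hhalf x y t
    have h₂ := hhalf y x t
    have hneg : (g y - g x) - μ • (y - x) = -((g x - g y) - μ • (x - y)) := by module
    rw [hneg, norm_neg, norm_sub_rev y x, ← neg_sub x y, inner_neg_right] at h₂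
    rw [inner_sub_left]
    linarith
  have h := le_mul_of_forall_quadratic_le (sub_nonneg.2 hμβ) hquad
  rw [norm_sub_sq_real, norm_smul, mul_pow, Real.norm_eq_abs, sq_abs,
    real_inner_smul_right] at h
  linarith

/-- A gradient step with step size at most `2 / (μ + β)` contracts distances by `1 - η * μ`. -/
theorem norm_gradient_step_sub_le [CompleteSpace E] (hμ : 0 < μ) (hμβ : μ ≤ β)
    (hdiff : ∀ w, HasGradientAt f (g w) w)
    (hstrong : ∀ w₁ w₂, f w₂ + ⟪g w₂, w₁ - w₂⟫ + μ / 2 * ‖w₁ - w₂‖ ^ 2 ≤ f w₁)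
    (hsmooth : ∀ w₁ w₂, ‖g w₁ - g w₂‖ ≤ β * ‖w₁ - w₂‖)
    {η : ℝ} (hη0 : 0 ≤ η) (hη : η ≤ 2 / (μ + β)) (x y : E) :
    ‖(x - η • g x) - (y - η • g y)‖ ≤ (1 - η * μ) * ‖x - y‖ := by
  have hs : 0 < μ + β := by linarith
  rw [le_div_iff₀ hs] at hη
  have hημ : 0 ≤ 1 - η * μ := by nlinarith
  have hco := norm_sq_gradient_sub_add_le_inner hμβ hdiff hstrong hsmooth x y
  have hmono : μ * ‖x - y‖ ^ 2 ≤ ⟪g x - g y, x - y⟫ := by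
    have h₁ := hstrong x y
    have h₂ := hstrong y x
    rw [norm_sub_rev y x, ← neg_sub x y, inner_neg_right] at h₂
    rw [inner_sub_left]
    linarith
  have hlower : μ * ‖x - y‖ ≤ ‖g x - g y‖ := by
    rcases (norm_nonneg (x - y)).eq_or_lt with h | h
    · rw [← h, mul_zero]
      exact norm_nonneg _
    · have hcs := real_inner_le_norm (g x - g y) (x - y)
      exact le_of_mul_le_mul_right (by linarith) h
  have hlower_sq : μ ^ 2 * ‖x - y‖ ^ 2 ≤ ‖g x - g y‖ ^ 2 := by
    rw [← mul_pow]
    exact pow_le_pow_left₀ (by positivity) hlower 2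
  refine (sq_le_sq₀ (norm_nonneg _) (mul_nonneg hημ (norm_nonneg _))).1 ?_
  have hsub : (x - η • g x) - (y - η • g y) = (x - y) - η • (g x - g y) := by module
  rw [hsub, norm_sub_sq_real, norm_smul, mul_pow, mul_pow, Real.norm_eq_abs, sq_abs,
    real_inner_smul_right, real_inner_comm]
  refine le_of_mul_le_mul_left ?_ hs
  have h₁ := mul_le_mul_of_nonneg_left hco (mul_nonneg zero_le_two hη0)
  have h₂ := mul_le_mul_of_nonneg_left hlower_sq (mul_nonneg hη0 (sub_nonneg.2 hη))
  linarith

end Gradient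

/-- One-step bound on the dispersion of the noise-free subnet variables:
if each subnet loss `F̄_c` is `μ`-strongly convex and `β`-smooth, the inter-subnet gradient
diversity bound `‖∇F̄_c(w) - ∇F(w)‖ ≤ δ + 2ωβ‖w - w*‖` holds (with `∇F = Σ_c ϱ_c ∇F̄_c`),
and `0 < η ≤ 2/(μ+β)`, then after one gradient step `v_c' = v_c - η ∇F̄_c(v_c)` we have
`Σ_c ϱ_c ‖v_c' - v̄'‖ ≤ (1 + η(β-μ)) Σ_c ϱ_c ‖v_c - v̄‖ + 2ωηβ‖v̄ - w*‖ + ηδ`. -/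
theorem dispersion_one_step
    (M N : ℕ) (Fb : Fin N → EuclideanSpace ℝ (Fin M) → ℝ)
    (g : Fin N → EuclideanSpace ℝ (Fin M) → EuclideanSpace ℝ (Fin M))
    (ϱ : Fin N → ℝ) (μ β ω δ η : ℝ)
    (wstar : EuclideanSpace ℝ (Fin M))
    (hϱ0 : ∀ c, 0 ≤ ϱ c) (hϱ1 : ∑ c, ϱ c = 1)
    (hμ : 0 < μ) (hμβ : μ ≤ β) (hω : 0 ≤ ω) (hδ : 0 ≤ δ)
    (hdiff : ∀ c w, HasGradientAt (Fb c) (g c w) w)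
    (hstrong : ∀ c, ∀ w₁ w₂ : EuclideanSpace ℝ (Fin M),
      Fb c w₂ + ⟪g c w₂, w₁ - w₂⟫ + μ / 2 * ‖w₁ - w₂‖ ^ 2 ≤ Fb c w₁)
    (hsmooth : ∀ c, ∀ w₁ w₂ : EuclideanSpace ℝ (Fin M),
      ‖g c w₁ - g c w₂‖ ≤ β * ‖w₁ - w₂‖)
    (hdiv : ∀ c w, ‖g c w - ∑ d, ϱ d • g d w‖ ≤ δ + 2 * ω * β * ‖w - wstar‖)
    (hη0 : 0 < η) (hη : η ≤ 2 / (μ + β))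
    (v : Fin N → EuclideanSpace ℝ (Fin M)) :
    ∑ c, ϱ c * ‖(v c - η • g c (v c)) - ∑ d, ϱ d • (v d - η • g d (v d))‖
      ≤ (1 + η * (β - μ)) * ∑ c, ϱ c * ‖v c - ∑ d, ϱ d • v d‖
        + 2 * ω * η * β * ‖(∑ d, ϱ d • v d) - wstar‖ + η * δ := by
  have hβ : 0 ≤ β := hμ.le.trans hμβ
  set vbar := ∑ d, ϱ d • v d with hvbar
  set S := ∑ c, ϱ c * ‖v c - vbar‖ with hS
  have hmean : ∑ d, ϱ d • (v d - η • g d (v d)) = vbar - η • ∑ d, ϱ d • g d (v d) := by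
    simp only [smul_sub, Finset.sum_sub_distrib, Finset.smul_sum, smul_comm η, hvbar]
  have hdrift : ‖∑ d, ϱ d • g d vbar - ∑ d, ϱ d • g d (v d)‖ ≤ β * S := by
    rw [← Finset.sum_sub_distrib, hS, Finset.mul_sum]
    refine norm_sum_le_of_le _ fun d _ ↦ ?_
    rw [← smul_sub, norm_smul, Real.norm_of_nonneg (hϱ0 d), norm_sub_rev (v d), mul_left_comm]
    exact mul_le_mul_of_nonneg_left (hsmooth d _ _) (hϱ0 d)
  have hterm : ∀ c, ‖(v c - η • g c (v c)) - ∑ d, ϱ d • (v d - η • g d (v d))‖ ≤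
      (1 - η * μ) * ‖v c - vbar‖ + η * (δ + 2 * ω * β * ‖vbar - wstar‖ + β * S) := by
    intro c
    have hsplit : (v c - η • g c (v c)) - ∑ d, ϱ d • (v d - η • g d (v d)) =
        ((v c - η • g c (v c)) - (vbar - η • g c vbar)) -
          η • ((g c vbar - ∑ d, ϱ d • g d vbar) +
            (∑ d, ϱ d • g d vbar - ∑ d, ϱ d • g d (v d))) := by
      rw [hmean]
      module
    rw [hsplit]
    refine (norm_sub_le _ _).trans (add_le_add
      (norm_gradient_step_sub_le hμ hμβ (hdiff c) (hstrong c) (hsmooth c) hη0.le hη _ _) ?_)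
    rw [norm_smul, Real.norm_of_nonneg hη0.le]
    exact mul_le_mul_of_nonneg_left
      ((norm_add_le _ _).trans (add_le_add (hdiv c vbar) hdrift)) hη0.le
  refine (Finset.sum_le_sum fun c _ ↦ mul_le_mul_of_nonneg_left (hterm c) (hϱ0 c)).trans
    (le_of_eq ?_)
  simp only [mul_add (ϱ _), Finset.sum_add_distrib, ← Finset.sum_mul, hϱ1,
    mul_left_comm (ϱ _) (1 - η * μ), ← Finset.mul_sum, ← hS]
  ring
end

section
/- Let β > μ > 0, ω > 0, δ ≥ 0, and let η > 0 satisfy ημ ≤ 1. Suppose b, c : ℕ → ℝ are nonnegative sequences satisfying b_{t+1} ≤ (1 + η(β − μ)) b_t + 2ωηβ c_t + ηδ and c_{t+1} ≤ (1 − ημ) c_t + ηβ b_t for all t ≥ 0. Then for every t ≥ 0, c_t ≤ (g₁Π₊(t) + g₂Π₋(t)) c_0 + (g₃Π₊(t) − g₃Π₋(t)) b_0 + (g₅(Π₊(t) − 1) + g₆(Π₋(t) − 1)) δ/β, where g₁ = (1/2)(1 − 1/√(8ω+1)), g₂ = (1/2)(1 + 1/√(8ω+1)), g₃ = 1/√(8ω+1),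 g₅ = 1/(λ₊√(8ω+1)), and g₆ = −1/(λ₋√(8ω+1)). -/
/-- Comparison principle for a cooperative two-dimensional linear recursion: a subsolution
starting below a solution stays below it. -/
theorem le_of_cooperative_recursion {b c B C : ℕ → ℝ} {p q r u v : ℝ}
    (hp : 0 ≤ p) (hq : 0 ≤ q) (hu : 0 ≤ u) (hv : 0 ≤ v)
    (hb : ∀ t, b (t + 1) ≤ p * b t + q * c t + r) (hc : ∀ t, c (t + 1) ≤ u * c t + v * b t)
    (hB : ∀ t, B (t + 1) = p * B t + q * C t + r) (hC : ∀ t, C (t + 1) = u * C t + v * B t)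
    (hb₀ : b 0 ≤ B 0) (hc₀ : c 0 ≤ C 0) (t : ℕ) : b t ≤ B t ∧ c t ≤ C t := by
  induction t with
  | zero => exact ⟨hb₀, hc₀⟩
  | succ t ih =>
    obtain ⟨hbt, hct⟩ := ih
    rw [hB, hC]
    exact ⟨(hb t).trans (by gcongr), (hc t).trans (by gcongr)⟩


/-- Exact solution bound for the optimality gap `c = e₃` component of the
coupled linear recursion, with `λ₊, λ₋` the eigenvalues of `B = [[1-μ/β, 2ω],[1, -μ/β]]`
and `Π±(t) = (1+ηβλ±)^t`, and constants `g₁, g₂, g₃, g₅, g₆`. -/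
theorem coupled_recursion_c_bound
    (μ β ω δ η lp lm : ℝ)
    (hμ : 0 < μ) (hμβ : μ < β) (hω : 0 < ω) (hδ : 0 ≤ δ)
    (hη : 0 < η) (hημ : η * μ ≤ 1)
    (hlp : lp = 1 / 2 - μ / β + Real.sqrt (8 * ω + 1) / 2)
    (hlm : lm = 1 / 2 - μ / β - Real.sqrt (8 * ω + 1) / 2)
    (b c : ℕ → ℝ)
    (hb : ∀ t, 0 ≤ b t) (hc : ∀ t, 0 ≤ c t)
    (hbrec : ∀ t, b (t + 1) ≤ (1 + η * (β - μ)) * b t + 2 * ω * η * β * c t + η * δ)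
    (hcrec : ∀ t, c (t + 1) ≤ (1 - η * μ) * c t + η * β * b t)
    (t : ℕ) :
    c t ≤ (1 / 2 * (1 - 1 / Real.sqrt (8 * ω + 1)) * (1 + η * β * lp) ^ t
            + 1 / 2 * (1 + 1 / Real.sqrt (8 * ω + 1)) * (1 + η * β * lm) ^ t) * c 0
      + (1 / Real.sqrt (8 * ω + 1) * (1 + η * β * lp) ^ t
            - 1 / Real.sqrt (8 * ω + 1) * (1 + η * β * lm) ^ t) * b 0
      + (1 / (lp * Real.sqrt (8 * ω + 1)) * ((1 + η * β * lp) ^ t - 1)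
            + (-(1 / (lm * Real.sqrt (8 * ω + 1)))) * ((1 + η * β * lm) ^ t - 1)) * (δ / β) := by
  have hβ : 0 < β := hμ.trans hμβ
  set s := Real.sqrt (8 * ω + 1) with hs
  have hss : s ^ 2 = 8 * ω + 1 := Real.sq_sqrt (by linarith)
  have hs0 : 0 ≤ s := Real.sqrt_nonneg _
  have hs1 : 1 < s := by nlinarith
  have hsne : s ≠ 0 := by linarith
  have hm0 : 0 < μ / β := div_pos hμ hβ
  have hm1 : μ / β < 1 := (div_lt_one hβ).2 hμβ
  have hlp0 : lp ≠ 0 := by linarith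
  have hlm0 : lm ≠ 0 := by linarith
  have hω' : ω = (s ^ 2 - 1) / 8 := by linarith
  obtain ⟨D, hD⟩ : ∃ D, D = δ / β := ⟨_, rfl⟩
  obtain ⟨m, hm⟩ : ∃ m, m = μ / β := ⟨_, rfl⟩
  have hδD : δ = D * β := by rw [hD]; field_simp
  have hμm : μ = m * β := by rw [hm]; field_simp
  rw [← hm] at hlp hlm
  rw [← hD]
  let X : ℕ → ℝ := fun t =>
    (1 / 2 * (1 - 1 / s) * c 0 + 1 / s * b 0 + D / (lp * s)) * (1 + η * β * lp) ^ t - D / (lp * s)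
  let Y : ℕ → ℝ := fun t =>
    (1 / 2 * (1 + 1 / s) * c 0 - 1 / s * b 0 - D / (lm * s)) * (1 + η * β * lm) ^ t + D / (lm * s)
  have hX : ∀ t, X (t + 1) = (1 + η * β * lp) * X t + η * β * D / s := by
    intro t
    simp only [X, pow_succ]
    field_simp
    ring
  have hY : ∀ t, Y (t + 1) = (1 + η * β * lm) * Y t - η * β * D / s := by
    intro t
    simp only [Y, pow_succ]
    field_simp
    ring
  have key := le_of_cooperative_recursion (B := fun t => (1 + s) / 2 * X t + (1 - s) / 2 * Y t)
    (C := fun t => X t + Y t) (p := 1 + η * (β - μ)) (q := 2 * ω * η * β)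
    (u := 1 - η * μ) (v := η * β)
    (by nlinarith) (by positivity) (by linarith) (by positivity) hbrec hcrec
    (fun t => by
      simp only [hX, hY]
      rw [hlp, hlm, hω', hδD, hμm]
      field_simp
      ring)
    (fun t => by
      simp only [hX, hY]
      rw [hlp, hlm, hμm]
      ring)
    (le_of_eq (by simp only [X, Y, pow_zero]; field_simp; ring))
    (le_of_eq (by simp only [X, Y, pow_zero]; field_simp; ring)) t
  refine key.2.trans (le_of_eq ?_)
  simp only [X, Y]
  field_simp
  ring
end

section
/- Let β > μ > 0, ω > 0, let Δ, τ be natural numbers with Δ ≤ τ, α ∈ [0,1], and let η, η_max satisfy 0 ≤ η ≤ η_max and η_maxβ ≤ 1. Set g₃ = 1/√(8ω+1) and C₂ = (2β/√(8ω+1))((1+λ₊)^τ − 1). Then 2g₃·((1 − α)Π₊(τ−Δ) + αΠ₊(τ) − 1) ≤ η·C₂. -/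
/-- Convexity of `x ↦ (1 + x * l) ^ n` on `[0, 1]`, as a chord bound. -/
theorem one_add_mul_pow_le_chord {x l : ℝ} (hx0 : 0 ≤ x) (hx1 : x ≤ 1) (hl : 0 ≤ l) (n : ℕ) :
    (1 + x * l) ^ n ≤ 1 + x * ((1 + l) ^ n - 1) := by
  induction n with
  | zero => simp
  | succ n ih =>
    have hP : 0 ≤ (1 + l) ^ n - 1 := sub_nonneg.2 (one_le_pow₀ (by linarith))
    have hxl : 0 ≤ 1 + x * l := by positivity
    have hprod : 0 ≤ x * (1 - x) * (l * ((1 + l) ^ n - 1)) :=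
      mul_nonneg (mul_nonneg hx0 (sub_nonneg.2 hx1)) (mul_nonneg hl hP)
    calc (1 + x * l) ^ (n + 1) = (1 + x * l) ^ n * (1 + x * l) := pow_succ _ _
      _ ≤ (1 + x * ((1 + l) ^ n - 1)) * (1 + x * l) := mul_le_mul_of_nonneg_right ih hxl
      _ ≤ 1 + x * ((1 + l) ^ (n + 1) - 1) := by
        rw [pow_succ]
        linarith

/-- Bound on the coefficient of the model-dispersion term in the
optimality-gap recursion across one global synchronization:
`2g₃((1-α)Π₊(τ-Δ) + αΠ₊(τ) - 1) ≤ η C₂`, where `g₃ = 1/√(8ω+1)`,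
`C₂ = (2β/√(8ω+1))((1+λ₊)^τ - 1)`. -/
theorem dispersion_coefficient_bound
    (μ β ω lp lm η ηmax α : ℝ) (Δ τ : ℕ)
    (hμ : 0 < μ) (hμβ : μ < β) (hω : 0 < ω)
    (hlp : lp = 1 / 2 - μ / β + Real.sqrt (8 * ω + 1) / 2)
    (hlm : lm = 1 / 2 - μ / β - Real.sqrt (8 * ω + 1) / 2)
    (hΔτ : Δ ≤ τ) (hα0 : 0 ≤ α) (hα1 : α ≤ 1)
    (hη0 : 0 ≤ η) (hη : η ≤ ηmax) (hηmaxβ : ηmax * β ≤ 1) :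
    2 * (1 / Real.sqrt (8 * ω + 1))
        * ((1 - α) * (1 + η * β * lp) ^ (τ - Δ) + α * (1 + η * β * lp) ^ τ - 1)
      ≤ η * (2 * β / Real.sqrt (8 * ω + 1) * ((1 + lp) ^ τ - 1)) := by
  have hβ : 0 < β := hμ.trans hμβ
  have hl : 0 ≤ lp := by
    have hs : 1 ≤ Real.sqrt (8 * ω + 1) := Real.one_le_sqrt.2 (by linarith)
    have hr : μ / β < 1 := (div_lt_one hβ).2 hμβ
    linarith
  have hx0 : 0 ≤ η * β := mul_nonneg hη0 hβ.le
  have hx1 : η * β ≤ 1 := (mul_le_mul_of_nonneg_right hη hβ.le).trans hηmaxβ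
  have hchord := one_add_mul_pow_le_chord hx0 hx1 hl τ
  have hmono : (1 + η * β * lp) ^ (τ - Δ) ≤ (1 + η * β * lp) ^ τ :=
    pow_le_pow_right₀ (by linarith [mul_nonneg hx0 hl]) (Nat.sub_le τ Δ)
  have hmix := mul_le_mul_of_nonneg_left hmono (sub_nonneg.2 hα1)
  calc _ ≤ 2 * (1 / Real.sqrt (8 * ω + 1)) * (η * β * ((1 + lp) ^ τ - 1)) :=
        mul_le_mul_of_nonneg_left (by linarith) (by positivity)
    _ = _ := by ring
end

section
/- Let η_max > 0, M ≥ 0, and 0 < γ < C₁ with C₁ ≤ 1, and set η_k = η_max/(1+γk) and Y₁² = M·η_max/(C₁ − γ). If a : ℕ → ℝ is nonnegative, a_0 ≤ η_max·Y₁², and a_{k+1} ≤ (1 − (η_k/η_max)C₁)·a_k + η_k²·M for all k ≥ 0, then a_k ≤ η_k·Y₁² for all k ≥ 0. -/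
/-- Induction step for the squared subnet deviation error: under the
step-size schedule `η_k = η_max/(1+γk)` with `0 < γ < C₁ ≤ 1` and
`Y₁² = M η_max/(C₁ - γ)`, if `a₀ ≤ η_max Y₁²` and
`a_{k+1} ≤ (1 - (η_k/η_max)C₁) a_k + η_k² M`, then `a_k ≤ η_k Y₁²` for all `k`. -/
theorem e1_induction_step
    (ηmax M γ C1 Y1sq : ℝ)
    (hηmax : 0 < ηmax) (hM : 0 ≤ M)
    (hγ0 : 0 < γ) (hγC1 : γ < C1) (hC1 : C1 ≤ 1)
    (hY1 : Y1sq = M * ηmax / (C1 - γ))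
    (a : ℕ → ℝ) (ha : ∀ k, 0 ≤ a k)
    (ha0 : a 0 ≤ ηmax * Y1sq)
    (harec : ∀ k : ℕ,
      a (k + 1) ≤ (1 - (ηmax / (1 + γ * k)) / ηmax * C1) * a k
        + (ηmax / (1 + γ * k)) ^ 2 * M) :
    ∀ k : ℕ, a k ≤ ηmax / (1 + γ * k) * Y1sq := by
  have hY : (C1 - γ) * Y1sq = M * ηmax := by
    rw [hY1, mul_div_cancel₀ _ (sub_pos.2 hγC1).ne']
  have hY0 : 0 ≤ Y1sq := hY1 ▸ div_nonneg (mul_nonneg hM hηmax.le) (sub_pos.2 hγC1).le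
  intro k
  induction k with
  | zero => simpa using ha0
  | succ k ih =>
    have ht1 : 1 ≤ 1 + γ * (k : ℝ) := le_add_of_nonneg_right (by positivity)
    have hrec := harec k
    have hcast : 1 + γ * ((k + 1 : ℕ) : ℝ) = (1 + γ * k) + γ := by push_cast; ring
    rw [hcast]
    generalize 1 + γ * (k : ℝ) = t at ht1 hrec ih ⊢
    have ht : 0 < t := one_pos.trans_le ht1
    have hcoef : ηmax / t / ηmax * C1 = C1 / t := by field_simp
    have hcontract : 0 ≤ 1 - C1 / t := sub_nonneg.2 ((div_le_one ht).2 (hC1.trans ht1))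
    rw [hcoef] at hrec
    calc
      a (k + 1) ≤ (1 - C1 / t) * a k + (ηmax / t) ^ 2 * M := hrec
      _ ≤ (1 - C1 / t) * (ηmax / t * Y1sq) + (ηmax / t) ^ 2 * M := by gcongr
      _ = ηmax * Y1sq * ((t - γ) / t ^ 2) := by
        field_simp
        linear_combination -hY
      _ ≤ ηmax * Y1sq * (1 / (t + γ)) := by
        gcongr ηmax * Y1sq * ?_
        rw [div_le_div_iff₀ (by positivity) (by positivity)]
        nlinarith [sq_nonneg γ]
      _ = ηmax / (t + γ) * Y1sq := by ring
end
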